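/- arXiv:2406.04033 — 2 statements merged into one kernel-verified Lean document; each statement's English description precedes it below -/
import Mathlib

section
/- For every number field k, the class number of k satisfies |Cl(k)| ≤ 2π · |Disc(k)|^{3/4}, where Cl(k) is the ideal class group of k and Disc(k) is the absolute discriminant of k. -/
open NumberField Ideal

theorem aux_sum (X : ℕ) (hX : 1 ≤ X) :
    ∑ m ∈ Finset.Icc 1 X, ((√(m:ℝ))^3)⁻¹ ≤ 3 - 2 / √(X:ℝ) := by
  induction X, hX using Nat.le_induction with
  | base => norm_num
  | succ n hn ih =>
    rw [Finset.sum_Icc_succ_top (by omega)]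
    have ha : 0 < √(n:ℝ) := Real.sqrt_pos.mpr (by exact_mod_cast hn)
    have hab : √(n:ℝ) ≤ √((n+1 : ℕ):ℝ) := Real.sqrt_le_sqrt (by push_cast; linarith)
    have ha2 : √(n:ℝ)^2 = n := Real.sq_sqrt (by positivity)
    have hb2 : √((n+1 : ℕ):ℝ)^2 = n + 1 := by rw [Real.sq_sqrt (by positivity)]; push_cast; ring
    set a := √(n:ℝ)
    set b := √((n+1 : ℕ):ℝ)
    have hb : 0 < b := lt_of_lt_of_le ha hab
    have key : (b^3)⁻¹ ≤ 2 / a - 2 / b := by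
      have h1 : (b - a) * (a + b) = 1 := by nlinarith
      have h2 : 2 / a - 2 / b = 2 / (a * b * (a + b)) := by
        field_simp
        linarith
      rw [h2, inv_eq_one_div, div_le_div_iff₀ (by positivity) (by positivity)]
      nlinarith [mul_pos ha hb, mul_nonneg hb.le (sub_nonneg.mpr hab), mul_nonneg (mul_pos hb hb).le (sub_nonneg.mpr hab), mul_nonneg (mul_pos ha hb).le (sub_nonneg.mpr hab)]
    linarith

theorem aux_step (n : ℕ) (hn : 3 ≤ n) : (64/27 : ℝ) * n^n ≤ (n+1:ℝ)^n := by
  have hn' : (3:ℝ) ≤ n := by exact_mod_cast hn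
  have h := one_add_mul_self_le_rpow_one_add (s := 1/(n:ℝ)) (by have : 0 ≤ 1/(n:ℝ) := by positivity
                                                                linarith) (p := n/3) (by linarith)
  have h0 : (1:ℝ) + n/3 * (1/n) = 4/3 := by field_simp; norm_num
  rw [h0] at h
  have h3 := pow_le_pow_left₀ (by norm_num) h 3
  rw [← Real.rpow_natCast (_ ^ _) 3, ← Real.rpow_mul (by positivity)] at h3
  have : (n:ℝ)/3 * ((3:ℕ):ℝ) = (n:ℕ) := by push_cast; ring
  rw [this, Real.rpow_natCast] at h3
  have e : (n+1:ℝ)^n = (1 + 1/(n:ℝ))^n * n^n := by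
    rw [← mul_pow]; congr 1; field_simp
  rw [e]
  have := mul_le_mul_of_nonneg_right h3 (show (0:ℝ) ≤ (n:ℝ)^n by positivity)
  norm_num at this ⊢
  linarith

theorem aux_const (n : ℕ) (hn : 1 ≤ n) :
    (168:ℝ)^n * (n.factorial / (n:ℝ)^n)^6 ≤ 1000 := by
  have hs : ∀ n : ℕ, 3 ≤ n → (168:ℝ)^n * (n.factorial / (n:ℝ)^n)^6 ≤ 1000 := by
    intro n hn
    induction n, hn using Nat.le_induction with
    | base => norm_num [Nat.factorial]
    | succ n hn ih =>
      refine le_trans ?_ ih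
      have h := aux_step n hn
      have hn0 : (0:ℝ) < n := by exact_mod_cast (by omega : 0 < n)
      have e : ((n+1).factorial : ℝ) / ((n+1:ℕ):ℝ)^(n+1) = n.factorial / (n+1:ℝ)^n := by
        rw [Nat.factorial_succ]; push_cast; rw [pow_succ]; field_simp
      have h2 : (n.factorial : ℝ) / (n+1:ℝ)^n ≤ 27/64 * (n.factorial / (n:ℝ)^n) := by
        rw [div_le_iff₀ (by positivity)]
        have : (n.factorial:ℝ) = 27/64 * (n.factorial / (n:ℝ)^n) * (64/27 * n^n) := by
          field_simp
        calc (n.factorial:ℝ) = 27/64 * (n.factorial / (n:ℝ)^n) * (64/27 * n^n) := this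
          _ ≤ _ := by gcongr
      have h3 := pow_le_pow_left₀ (by positivity) h2 6
      rw [e]
      calc _ ≤ (168:ℝ)^(n+1) * (27/64 * (n.factorial / (n:ℝ)^n))^6 := by gcongr
        _ = (168 * (27/64)^6) * ((168:ℝ)^n * (n.factorial / (n:ℝ)^n)^6) := by ring
        _ ≤ 1 * ((168:ℝ)^n * (n.factorial / (n:ℝ)^n)^6) := by
          gcongr; norm_num
        _ = _ := one_mul _
  rcases (by omega : n = 1 ∨ n = 2 ∨ 3 ≤ n) with rfl | rfl | h
  · norm_num
  · norm_num [Nat.factorial]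
  · exact hs n h

theorem aux_final (n r : ℕ) (hn : 1 ≤ n) (hr : 2 * r ≤ n) (D : ℝ) (hD : 0 ≤ D) :
    (√((4 / Real.pi)^r * (n.factorial / (n:ℝ)^n * √D)))^3 * 3^n ≤ 2 * Real.pi * D^((3:ℝ)/4) := by
  have hpi := Real.pi_gt_d2
  set c : ℝ := (4 / Real.pi)^r * (n.factorial / (n:ℝ)^n) with hc
  have hc0 : 0 ≤ c := by positivity
  have h1 : 1 ≤ 4 / Real.pi := by rw [le_div_iff₀ Real.pi_pos]; linarith [Real.pi_le_four]
  have h2 : (4 / Real.pi)^3 * 81 ≤ 168 := by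
    have : 4 / Real.pi ≤ 1.2739 := by
      rw [div_le_iff₀ Real.pi_pos]; nlinarith
    calc (4 / Real.pi)^3 * 81 ≤ 1.2739^3*81 := by gcongr
      _ ≤ _ := by norm_num
  have hb : c^6 * 81^n ≤ 1000 := by
    refine le_trans ?_ (aux_const n hn)
    calc c^6 * 81^n = ((4 / Real.pi)^(2*r))^3 * 81^n * (n.factorial / (n:ℝ)^n)^6 := by
          rw [hc]; ring
      _ ≤ ((4 / Real.pi)^n)^3 * 81^n * (n.factorial / (n:ℝ)^n)^6 := by gcongr
      _ = ((4 / Real.pi)^3 * 81)^n * (n.factorial / (n:ℝ)^n)^6 := by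
          rw [mul_pow, ← pow_mul, ← pow_mul, mul_comm 3 n]
      _ ≤ _ := by gcongr
  have hk : √c^3 * 3^n ≤ 2 * Real.pi := by
    refine le_of_pow_le_pow_left₀ (n := 4) (by norm_num) (by positivity) ?_
    calc (√c^3 * 3^n)^4 = (√c^2)^6 * 81^n := by
          rw [show (81:ℝ) = 3^4 by norm_num, ← pow_mul, ← pow_mul]; ring
      _ = c^6 * 81^n := by rw [Real.sq_sqrt hc0]
      _ ≤ 1000 := hb
      _ ≤ (2*3.14)^4 := by norm_num
      _ ≤ _ := by gcongr
  have hDD : √(√D)^3 = D^((3:ℝ)/4) := by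
    rw [Real.sqrt_eq_rpow, Real.sqrt_eq_rpow, ← Real.rpow_mul hD, ← Real.rpow_natCast, ← Real.rpow_mul hD]
    norm_num
  rw [← mul_assoc, Real.sqrt_mul hc0, mul_pow, hDD]
  have : 0 ≤ D^((3:ℝ)/4) := by positivity
  nlinarith

theorem aux_under {k : Type} [Field k] [NumberField k] (P : Ideal (𝓞 k)) [P.IsPrime] (hP : P ≠ ⊥) :
    (absNorm (P.under ℤ)).Prime ∧ ∃ f, 0 < f ∧ absNorm P = absNorm (P.under ℤ) ^ f := by
  have hu : P.under ℤ ≠ ⊥ := Ideal.under_ne_bot ℤ hP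
  have : (P.under ℤ).IsPrime := inferInstance
  refine ⟨?_, P.inertiaDeg ℤ, Ideal.inertiaDeg_pos P ℤ, (Ideal.absNorm_pow_inertiaDeg (P.under ℤ) P).symm⟩
  exact (Int.prime_absNorm (P.under ℤ)).mpr (Ideal.prime_of_isPrime hu this)

theorem aux_label (k : Type) [Field k] [NumberField k] :
    ∃ L : Ideal (𝓞 k) → Fin (Module.finrank ℚ k), ∀ P Q : Ideal (𝓞 k), P.IsPrime → P ≠ ⊥ →
      Q.IsPrime → Q ≠ ⊥ → P.under ℤ = Q.under ℤ → L P = L Q → P = Q := by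
  have key : ∀ p : Ideal ℤ, ∃ f : Ideal (𝓞 k) → Fin (Module.finrank ℚ k),
      p.IsPrime → p ≠ ⊥ → Set.InjOn f (primesOver p (𝓞 k)) := by
    intro p
    have hpos : 0 < Module.finrank ℚ k := Module.finrank_pos
    have : Nonempty (Fin (Module.finrank ℚ k)) := ⟨⟨0, hpos⟩⟩
    by_cases hp : p.IsPrime ∧ p ≠ ⊥
    · have := hp.1
      have : p.IsMaximal := hp.1.isMaximal hp.2
      have hc := Ideal.card_primesOverFinset_le_finrank (𝓞 k) ℚ k hp.2
      have hc' : Fintype.card (IsDedekindDomain.primesOverFinset p (𝓞 k)) ≤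
          Fintype.card (Fin (Module.finrank ℚ k)) := by
        rw [Fintype.card_coe, Fintype.card_fin]; exact hc
      obtain ⟨e⟩ := Function.Embedding.nonempty_of_card_le hc'
      obtain ⟨f, hf⟩ := (Set.exists_injOn_iff_injective
        (s := {P | P ∈ IsDedekindDomain.primesOverFinset p (𝓞 k)})).mpr ⟨e, e.injective⟩
      refine ⟨f, fun _ _ => hf.mono ?_⟩
      intro P hP
      exact (IsDedekindDomain.mem_primesOverFinset_iff hp.2 _).mpr hP
    · exact ⟨fun _ => ⟨0, hpos⟩, fun h1 h2 => absurd ⟨h1, h2⟩ hp⟩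
  choose f hf using key
  refine ⟨fun P => f (P.under ℤ) P, fun P Q hP hP0 hQ hQ0 hPQ hL => ?_⟩
  refine hf (P.under ℤ) inferInstance (Ideal.under_ne_bot ℤ hP0) ⟨hP, ⟨rfl⟩⟩ ⟨hQ, ⟨hPQ⟩⟩ ?_
  simpa [hPQ] using hL

open UniqueFactorizationMonoid

theorem aux_count {k : Type} [Field k] [NumberField k] [DecidableEq (Ideal (𝓞 k))]
    (P : Ideal (𝓞 k)) [P.IsPrime] (hP : P ≠ ⊥)
    (s : Multiset (Ideal (𝓞 k)))
    (hs : ∀ Q ∈ s, Q.IsPrime ∧ Q ≠ ⊥ ∧ (P.under ℤ = Q.under ℤ → P = Q)) :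
    (s.map absNorm).prod ≠ 0 ∧
    (s.map absNorm).prod.factorization (absNorm (P.under ℤ)) =
      s.count P * (absNorm P).factorization (absNorm (P.under ℤ)) := by
  induction s using Multiset.induction_on with
  | empty => simp
  | cons Q s ih =>
    obtain ⟨h0, h1⟩ := ih fun R hR => hs R (Multiset.mem_cons_of_mem hR)
    obtain ⟨hQ, hQ0, hPQ⟩ := hs Q (Multiset.mem_cons_self Q s)
    have hQn : absNorm Q ≠ 0 := fun h => hQ0 (Ideal.absNorm_eq_zero_iff.mp h)
    rw [Multiset.map_cons, Multiset.prod_cons]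
    refine ⟨mul_ne_zero hQn h0, ?_⟩
    rw [Nat.factorization_mul hQn h0, Finsupp.add_apply, h1]
    by_cases h : P = Q
    · subst h
      rw [Multiset.count_cons_self]; ring
    · rw [Multiset.count_cons_of_ne h]
      obtain ⟨hp, -⟩ := aux_under P hP
      obtain ⟨hq, f, hf, hN⟩ := aux_under Q hQ0
      have hne : absNorm (Q.under ℤ) ≠ absNorm (P.under ℤ) := by
        intro he
        apply h
        apply hPQ
        rw [← Int.ideal_span_absNorm_eq_self (P.under ℤ), ← he, Int.ideal_span_absNorm_eq_self]
      rw [hN, hq.factorization_pow, Finsupp.single_eq_of_ne hne.symm, zero_add]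

theorem aux_tuple (k : Type) [Field k] [NumberField k] :
    ∃ φ : Ideal (𝓞 k) → Fin (Module.finrank ℚ k) → ℕ,
      (∀ I, I ≠ ⊥ → ∏ j, φ I j = absNorm I) ∧
      (∀ I J, I ≠ ⊥ → J ≠ ⊥ → φ I = φ J → I = J) := by
  classical
  obtain ⟨L, hL⟩ := aux_label k
  refine ⟨fun I j => (((normalizedFactors I).filter (fun P => L P = j)).map absNorm).prod, ?_, ?_⟩
  · intro I hI
    have h : ∀ s : Multiset (Ideal (𝓞 k)),
        ∏ j, ((s.filter (fun P => L P = j)).map absNorm).prod = absNorm s.prod := by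
      intro s
      induction s using Multiset.induction_on with
      | empty => simp
      | cons Q s ih =>
        rw [Multiset.prod_cons, map_mul, ← ih]
        have : ∀ j, (((Q ::ₘ s).filter (fun P => L P = j)).map absNorm).prod =
            (if L Q = j then absNorm Q else 1) * ((s.filter (fun P => L P = j)).map absNorm).prod := by
          intro j
          by_cases hj : L Q = j
          · rw [Multiset.filter_cons_of_pos (p := fun P => L P = j) _ hj, if_pos hj]; simp
          · rw [Multiset.filter_cons_of_neg (p := fun P => L P = j) _ hj, if_neg hj, one_mul]
        simp only [this, Finset.prod_mul_distrib, Finset.prod_ite_eq, Finset.mem_univ, if_true]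
    rw [h, Ideal.prod_normalizedFactors_eq_self hI]
  · intro I J hI hJ hIJ
    rw [← Ideal.prod_normalizedFactors_eq_self hI, ← Ideal.prod_normalizedFactors_eq_self hJ]
    congr 1
    have hprime : ∀ I : Ideal (𝓞 k), ∀ P ∈ normalizedFactors I, P.IsPrime ∧ P ≠ ⊥ := by
      intro I P hP
      have := prime_of_normalized_factor P hP
      exact ⟨Ideal.isPrime_of_prime this, this.ne_zero⟩
    ext P
    by_cases hP : P.IsPrime ∧ P ≠ ⊥
    · have := hP.1
      have hc : ∀ I : Ideal (𝓞 k),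
          ((((normalizedFactors I).filter (fun Q => L Q = L P)).map absNorm).prod).factorization
            (absNorm (P.under ℤ)) = (normalizedFactors I).count P *
              (absNorm P).factorization (absNorm (P.under ℤ)) := by
        intro I
        rw [(aux_count P hP.2 _ ?_).2, Multiset.count_filter_of_pos (p := fun Q => L Q = L P) rfl]
        intro Q hQ
        rw [Multiset.mem_filter] at hQ
        obtain ⟨h1, h2⟩ := hprime I Q hQ.1
        exact ⟨h1, h2, fun hu => hL P Q hP.1 hP.2 h1 h2 hu hQ.2.symm⟩
      have h1 := hc I
      have h2 := hc J
      have h3 := congrFun hIJ (L P)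
      simp only at h3
      rw [h3, h2] at h1
      obtain ⟨hp, f, hf, hN⟩ := aux_under P hP.2
      have hpos : 0 < (absNorm P).factorization (absNorm (P.under ℤ)) := by
        rw [hN, hp.factorization_pow, Finsupp.single_eq_same]; exact hf
      exact (Nat.eq_of_mul_eq_mul_right hpos h1).symm
    · rw [Multiset.count_eq_zero_of_notMem fun h => hP (hprime I P h),
        Multiset.count_eq_zero_of_notMem fun h => hP (hprime J P h)]

set_option maxHeartbeats 2000000 in
/-- Lemma 3.1: the class number bound `|Cl(k)| ≤ 2π · |Disc(k)|^{3/4}` for every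
number field `k`. -/
theorem stmt10 (k : Type) [Field k] [NumberField k] :
    (NumberField.classNumber k : ℝ) ≤
      2 * Real.pi * |(NumberField.discr k : ℝ)| ^ ((3 : ℝ) / 4) := by
  classical
  obtain ⟨φ, hφ, hinj⟩ := aux_tuple k
  have hr := InfinitePlace.card_add_two_mul_card_eq_rank k
  refine le_trans ?_ (aux_final (Module.finrank ℚ k) (InfinitePlace.nrComplexPlaces k)
    Module.finrank_pos (by omega) |(NumberField.discr k : ℝ)| (abs_nonneg _))
  choose g hg hgM using fun C => exists_ideal_in_class_of_norm_le (K := k) C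
  set M : ℝ := (4 / Real.pi) ^ InfinitePlace.nrComplexPlaces k *
    ((Module.finrank ℚ k).factorial / (Module.finrank ℚ k : ℝ) ^ (Module.finrank ℚ k) * √|(NumberField.discr k : ℝ)|) with hM
  have hM0 : 0 ≤ M := by positivity
  have hg0 : ∀ C, (g C : Ideal (𝓞 k)) ≠ ⊥ := fun C => nonZeroDivisors.coe_ne_zero (g C)
  have hφ1 : ∀ C j, 1 ≤ φ (g C) j := by
    intro C j
    have h := hφ _ (hg0 C)
    have h' : ∏ j, φ (g C) j ≠ 0 := by
      rw [h]; exact fun h => hg0 C (Ideal.absNorm_eq_zero_iff.mp h)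
    exact Nat.one_le_iff_ne_zero.mpr (Finset.prod_ne_zero_iff.mp h' j (Finset.mem_univ j))
  have hφX : ∀ C j, φ (g C) j ≤ ⌊M⌋₊ := by
    intro C j
    refine le_trans ?_ (Nat.le_floor (hgM C))
    rw [← hφ _ (hg0 C)]
    exact Finset.single_le_prod' (f := φ (g C)) (fun i _ => hφ1 C i) (Finset.mem_univ j)
  let w : ℕ → ℝ := fun m => ((√(m:ℝ))^3)⁻¹
  have hw : ∀ m, 0 ≤ w m := fun m => by positivity
  have hone : ∀ C, (1:ℝ) ≤ √M^3 * ∏ j, w (φ (g C) j) := by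
    intro C
    have e : ∏ j, w (φ (g C) j) = ((√(absNorm (g C : Ideal (𝓞 k)) : ℝ))^3)⁻¹ := by
      rw [← hφ _ (hg0 C)]
      simp only [w]
      rw [Finset.prod_inv_distrib, Finset.prod_pow, Nat.cast_prod,
        Real.sqrt_prod _ (fun i _ => Nat.cast_nonneg _)]
    have hpos : (0:ℝ) < absNorm (g C : Ideal (𝓞 k)) := by
      exact_mod_cast Ideal.absNorm_pos_of_nonZeroDivisors (g C)
    rw [e, ← div_eq_mul_inv, one_le_div (by positivity)]
    have := hgM C
    gcongr
  have hX : 1 ≤ ⌊M⌋₊ := by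
    have := Module.finrank_pos (R := ℚ) (M := k)
    exact (hφ1 1 ⟨0, this⟩).trans (hφX 1 _)
  have hsum : ∑ m ∈ Finset.Icc 1 ⌊M⌋₊, w m ≤ 3 := by
    have h1 := aux_sum _ hX
    have h2 : 0 ≤ 2 / √(⌊M⌋₊ : ℝ) := by positivity
    simp only [w]; linarith
  have hginj : Function.Injective fun C => φ (g C) := by
    intro C C' h
    have h := hinj _ _ (hg0 C) (hg0 C') h
    rw [← hg C, ← hg C', Subtype.ext h]
  calc (NumberField.classNumber k : ℝ) = ∑ C : ClassGroup (𝓞 k), (1:ℝ) := by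
        simp [NumberField.classNumber]
    _ ≤ ∑ C : ClassGroup (𝓞 k), √M^3 * ∏ j, w (φ (g C) j) := Finset.sum_le_sum fun C _ => hone C
    _ = √M^3 * ∑ C : ClassGroup (𝓞 k), ∏ j, w (φ (g C) j) := by rw [Finset.mul_sum]
    _ = √M^3 * ∑ x ∈ Finset.univ.image (fun C => φ (g C)), ∏ j, w (x j) := by
        rw [Finset.sum_image hginj.injOn]
    _ ≤ √M^3 * ∑ x ∈ Fintype.piFinset (fun _ : Fin (Module.finrank ℚ k) => Finset.Icc 1 ⌊M⌋₊), ∏ j, w (x j) := by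
        refine mul_le_mul_of_nonneg_left ?_ (by positivity)
        refine Finset.sum_le_sum_of_subset_of_nonneg ?_
          fun x _ _ => Finset.prod_nonneg fun j _ => hw _
        intro x hx
        obtain ⟨C, -, rfl⟩ := Finset.mem_image.mp hx
        exact Fintype.mem_piFinset.mpr fun j => Finset.mem_Icc.mpr ⟨hφ1 C j, hφX C j⟩
    _ = √M^3 * (∑ m ∈ Finset.Icc 1 ⌊M⌋₊, w m)^(Module.finrank ℚ k) := by
        rw [← Finset.prod_univ_sum (fun _ : Fin (Module.finrank ℚ k) => Finset.Icc 1 ⌊M⌋₊) (fun _ m => w m)]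
        simp
    _ ≤ √M^3 * 3^(Module.finrank ℚ k) := by
        have : 0 ≤ ∑ m ∈ Finset.Icc 1 ⌊M⌋₊, w m := Finset.sum_nonneg fun m _ => hw m
        gcongr
end

section
/- Let G be a finite group of order n, acting on the polynomial ring ℤ[x_g : g ∈ G] in n variables by permuting the variables via the left regular representation (h · x_g = x_{hg}). Let n₂ be the number of elements of G of order 2. Then there exists an algebraically independent family f₁, …, f_n of G-invariant polynomials in ℤ[x_g : g ∈ G] with deg f₁ = 1, deg f_i = 2 for 2 ≤ i ≤ (n + n₂ + 1)/2, and deg f_i = 3 for (n + n₂ + 1)/2 < i ≤ n. Moreover this degree sequence is minimal: for any algebraically independent family f′₁, …, f′_n of G-invariant polynomials with deg f′_i ≤ deg f′_{i+1} for all i, one has deg f′_i ≥ deg f_i for every i. -/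
open MvPolynomial

namespace Stmt18

theorem chain_rule {σ τ : Type} [Fintype σ] (f : σ → MvPolynomial τ ℤ)
    (j : τ) (P : MvPolynomial σ ℤ) :
    pderiv j (aeval f P) = ∑ i, aeval f (pderiv i P) * pderiv j (f i) := by
  classical
  induction P using MvPolynomial.induction_on with
  | C a => simp
  | add p q hp hq => simp only [map_add, hp, hq, add_mul, Finset.sum_add_distrib]
  | mul_X p a h =>
    simp only [map_mul, aeval_X, pderiv_mul, h, map_add, add_mul, Finset.sum_add_distrib,
      Finset.sum_mul]
    congr 1
    · refine Finset.sum_congr rfl fun i _ => ?_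
      ring
    · simp [pderiv_X, Pi.single_apply, apply_ite]

theorem eq_C_of_pderiv {σ : Type} (P : MvPolynomial σ ℤ) (h : ∀ i, pderiv i P = 0) :
    P = C (coeff 0 P) := by
  classical
  ext m
  rw [coeff_C]
  split_ifs with hm
  · rw [hm]
  · obtain ⟨i, hi⟩ : ∃ i, m i ≠ 0 := by
      by_contra! hc
      exact hm (by ext i; simp [hc i])
    have h1 := coeff_pderiv (i := i) P (m - Finsupp.single i 1)
    rw [h i, Finsupp.sub_add_single_one_cancel hi, coeff_zero] at h1
    rcases mul_eq_zero.mp h1.symm with h2 | h2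
    · exact h2
    · exfalso
      have : (0:ℤ) ≤ (((m - Finsupp.single i 1 : σ →₀ ℕ) i : ℕ) : ℤ) := by positivity
      omega

theorem totalDegree_pderiv {σ : Type} (P : MvPolynomial σ ℤ) (n : ℕ) (i : σ)
    (h : P.totalDegree ≤ n + 1) : (pderiv i P).totalDegree ≤ n := by
  classical
  rw [totalDegree, Finset.sup_le_iff] at h ⊢
  intro m hm
  rw [mem_support_iff, coeff_pderiv] at hm
  have := h _ (mem_support_iff.mpr (left_ne_zero_of_mul hm))
  rw [Finsupp.sum_add_index' (by simp) (by simp), Finsupp.sum_single_index rfl] at this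
  omega

theorem jacobian {σ : Type} [Fintype σ] [DecidableEq σ] (f : σ → MvPolynomial σ ℤ) (p : σ → ℤ)
    (h : ∀ w : σ → ℤ, (∀ i, ∑ j, eval p (pderiv j (f i)) * w j = 0) → w = 0) :
    AlgebraicIndependent ℤ f := by
  set J : Matrix σ σ (MvPolynomial σ ℤ) := Matrix.of fun i j => pderiv j (f i) with hJ
  have hdet : J.det ≠ 0 := by
    intro h0
    have h1 : ((eval p).mapMatrix J).det = 0 := by
      rw [← RingHom.map_det, h0, map_zero]
    obtain ⟨w, hw, hw0⟩ := Matrix.exists_mulVec_eq_zero_iff.mpr h1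
    exact hw (h w fun i => by simpa [Matrix.mulVec, dotProduct, hJ] using congrFun hw0 i)
  rw [algebraicIndependent_iff]
  suffices H : ∀ n : ℕ, ∀ P : MvPolynomial σ ℤ, P.totalDegree ≤ n → aeval f P = 0 → P = 0 from
    fun P hP => H _ P le_rfl hP
  intro n
  have hC : ∀ P : MvPolynomial σ ℤ, P = C (coeff 0 P) → aeval f P = 0 → P = 0 := by
    intro P hP h0
    rw [hP] at h0 ⊢
    simpa using h0
  induction n with
  | zero =>
    intro P hd h0
    exact hC P (totalDegree_eq_zero_iff_eq_C.mp (by omega)) h0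
  | succ n ih =>
    intro P hd h0
    refine hC P (eq_C_of_pderiv P fun i => ih _ (totalDegree_pderiv P n i hd) ?_) h0
    have hv : Matrix.vecMul (fun i => aeval f (pderiv i P)) J = 0 := by
      ext1 j
      have := chain_rule f j P
      rw [h0, map_zero] at this
      simpa [Matrix.vecMul, dotProduct, hJ] using this.symm
    exact congrFun (Matrix.eq_zero_of_vecMul_eq_zero hdet hv) i

/-- cardinality bound -/
theorem card_le {ι κ : Type} [Fintype ι] [Fintype κ] {σ : Type}
    (f : ι → MvPolynomial σ ℤ) (g : κ → MvPolynomial σ ℤ) (hf : AlgebraicIndependent ℤ f)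
    (h : ∀ i, ∃ n : ℤ, n ≠ 0 ∧ C n * f i ∈ Algebra.adjoin ℤ (Set.range g)) :
    Fintype.card ι ≤ Fintype.card κ := by
  have hI : (AlgebraicIndependent.matroid ℤ (MvPolynomial σ ℤ)).Indep (Set.range f) :=
    AlgebraicIndependent.matroid_indep_iff.mpr hf.coe_range
  have hsub : Set.range f ⊆ (AlgebraicIndependent.matroid ℤ (MvPolynomial σ ℤ)).closure (Set.range g) := by
    rw [AlgebraicIndependent.matroid_closure_eq]
    rintro _ ⟨i, rfl⟩
    obtain ⟨n, hn, hm⟩ := h i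
    rw [SetLike.mem_coe, Subalgebra.mem_algebraicClosure]
    have hn' : (algebraMap ℤ (Algebra.adjoin ℤ (Set.range g)) n) ≠ 0 := by
      intro h0
      apply hn
      have : (C n : MvPolynomial σ ℤ) = 0 :=
        congrArg (fun x : Algebra.adjoin ℤ (Set.range g) => (x : MvPolynomial σ ℤ)) h0
      exact C_injective σ ℤ (by simpa using this)
    refine ⟨Polynomial.C (algebraMap ℤ (Algebra.adjoin ℤ (Set.range g)) n) * Polynomial.X
      - Polynomial.C ⟨_, hm⟩, ?_, ?_⟩
    · intro h0
      have := congrArg (fun q => Polynomial.coeff q 1) h0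
      simp [Polynomial.coeff_C] at this
      exact hn' (by simpa using this)
    · simp [Subalgebra.algebraMap_def]
  have h1 := hI.encard_le_eRk_of_subset hsub
  rw [Matroid.eRk_closure_eq] at h1
  have h2 := h1.trans (Matroid.eRk_le_encard _ _)
  have h3 : (Set.range g).encard ≤ Fintype.card κ := by
    rw [← Set.image_univ]
    refine (Set.encard_image_le _ _).trans ?_
    simp
  have h4 : (Set.range f).encard = Fintype.card ι := by
    rw [← Set.image_univ, hf.injective.encard_image]
    simp
  rw [h4] at h2
  exact_mod_cast h2.trans h3


section

variable {G : Type} [Group G] [Fintype G]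

/-- linear invariant -/
noncomputable def lin (G : Type) [Fintype G] : MvPolynomial G ℤ := ∑ g, X g

/-- quadratic invariants -/
noncomputable def quad (a : G) : MvPolynomial G ℤ := ∑ g, X g * X (g * a)

/-- cubic invariants -/
noncomputable def cub (a : G) : MvPolynomial G ℤ := ∑ g, X g * X g * X (g * a)

theorem lin_inv (h : G) : rename (fun g => h * g) (lin G) = lin G := by
  simp only [lin, map_sum, rename_X]
  exact Fintype.sum_equiv (Equiv.mulLeft h) _ _ fun g => by simp

theorem quad_inv (a h : G) : rename (fun g => h * g) (quad a) = quad a := by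
  simp only [quad, map_sum, map_mul, rename_X]
  exact Fintype.sum_equiv (Equiv.mulLeft h) _ _ fun g => by simp [mul_assoc]

theorem cub_inv (a h : G) : rename (fun g => h * g) (cub a) = cub a := by
  simp only [cub, map_sum, map_mul, rename_X]
  exact Fintype.sum_equiv (Equiv.mulLeft h) _ _ fun g => by simp [mul_assoc]

theorem quad_symm (a : G) : quad a⁻¹ = quad a := by
  simp only [quad]
  exact Fintype.sum_equiv (Equiv.mulRight a⁻¹) _ _ fun g => by simp [mul_comm]

theorem sum_quad : ∑ a : G, quad a = lin G * lin G := by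
  simp only [quad, lin, Finset.sum_mul_sum]
  rw [Finset.sum_comm]
  refine Finset.sum_congr rfl fun g _ => ?_
  exact Fintype.sum_equiv (Equiv.mulLeft g) _ _ fun g => by simp

theorem lin_hom : (lin G).IsHomogeneous 1 :=
  IsHomogeneous.sum _ _ _ fun g _ => isHomogeneous_X _ _

theorem quad_hom (a : G) : (quad a).IsHomogeneous 2 :=
  IsHomogeneous.sum _ _ _ fun g _ => (isHomogeneous_X _ _).mul (isHomogeneous_X _ _)

theorem cub_hom (a : G) : (cub a).IsHomogeneous 3 :=
  IsHomogeneous.sum _ _ _ fun g _ =>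
    ((isHomogeneous_X _ _).mul (isHomogeneous_X _ _)).mul (isHomogeneous_X _ _)

theorem lin_deriv [DecidableEq G] (j : G) :
    eval (Pi.single (1 : G) (1 : ℤ)) (pderiv j (lin G)) = 1 := by
  simp [lin, pderiv_X, Pi.single_apply, apply_ite]

theorem ev_X [DecidableEq G] (g : G) :
    eval (Pi.single (1 : G) (1 : ℤ)) (X g) = if g = 1 then 1 else 0 := by
  simp [Pi.single_apply]

theorem ev_pderiv_X [DecidableEq G] (g j : G) :
    eval (Pi.single (1 : G) (1 : ℤ)) (pderiv j (X g)) = if g = j then 1 else 0 := by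
  rw [pderiv_X, Pi.single_apply]
  split_ifs <;> simp

theorem quad_deriv [DecidableEq G] (a j : G) :
    eval (Pi.single (1 : G) (1 : ℤ)) (pderiv j (quad a)) =
      (if j = a⁻¹ then 1 else 0) + (if j = a then 1 else 0) := by
  simp only [quad, map_sum, pderiv_mul, map_add, map_mul, ev_X, ev_pderiv_X,
    Finset.sum_add_distrib, ite_mul, one_mul, zero_mul, Finset.sum_ite_eq', Finset.mem_univ,
    if_true, mul_eq_one_iff_eq_inv, @eq_comm _ a j]

theorem cub_deriv [DecidableEq G] (a j : G) (ha : a ≠ 1) :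
    eval (Pi.single (1 : G) (1 : ℤ)) (pderiv j (cub a)) = (if j = a then 1 else 0) := by
  simp only [cub, map_sum, pderiv_mul, map_add, map_mul, ev_X, ev_pderiv_X,
    Finset.sum_add_distrib, ite_mul, one_mul, zero_mul, Finset.sum_ite_eq', Finset.mem_univ,
    if_true, mul_eq_one_iff_eq_inv, @eq_comm _ a j, add_mul]
  rcases eq_or_ne j 1 with rfl | hj
  · have : (1 : G) ≠ a⁻¹ := fun h => ha (by simpa using h.symm)
    simp [this]
  · simp [hj, hj.symm]

theorem avg_mem (A : Subalgebra ℤ (MvPolynomial G ℤ)) (k : ℕ) (hk : k ≤ 2)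
    (h1 : 1 ≤ k → lin G ∈ A) (h2 : 2 ≤ k → ∀ a : G, quad a ∈ A)
    (p : MvPolynomial G ℤ) (hp : p.totalDegree ≤ k) :
    ∑ h : G, rename (fun g => h * g) p ∈ A := by
  classical
  have hC : ∀ a : ℤ, (C a : MvPolynomial G ℤ) ∈ A := fun a => A.algebraMap_mem a
  have e : ∀ h : G, rename (fun g => h * g) p =
      ∑ m ∈ p.support, rename (fun g => h * g) (monomial m (coeff m p)) := by
    intro h
    conv_lhs => rw [p.as_sum]
    rw [map_sum]
  simp only [e]
  rw [Finset.sum_comm]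
  refine A.sum_mem fun m hm => ?_
  generalize coeff m p = a
  have hd : m.degree ≤ k := (le_totalDegree hm).trans hp
  have key : ∀ m : G →₀ ℕ, m ≠ 0 → ∃ g m', m = Finsupp.single g 1 + m' := by
    intro m hm
    obtain ⟨g, hg⟩ : ∃ g, m g ≠ 0 := by
      by_contra! hc
      exact hm (by ext i; simp [hc i])
    exact ⟨g, m - Finsupp.single g 1, by
      rw [add_comm, Finsupp.sub_add_single_one_cancel hg]⟩
  by_cases hm0 : m = 0
  · subst hm0
    simp only [monomial_zero', rename_C]
    exact A.sum_mem fun _ _ => hC a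
  obtain ⟨g, m', rfl⟩ := key m hm0
  rw [map_add, Finsupp.degree_single] at hd
  by_cases hm1 : m' = 0
  · subst hm1
    have : ∑ h : G, rename (fun g => h * g) (monomial (Finsupp.single g 1 + 0) a) =
        C a * lin G := by
      simp only [lin, Finset.mul_sum]
      refine Fintype.sum_equiv (Equiv.mulRight g) _ _ fun h => ?_
      simp [rename_monomial, C_mul_X_eq_monomial, -eq_intCast]
    rw [this]
    exact A.mul_mem (hC a) (h1 (by omega))
  obtain ⟨g', m'', rfl⟩ := key m' hm1
  rw [map_add, Finsupp.degree_single] at hd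
  have hm2 : m'' = 0 := by
    rw [← Finsupp.degree_eq_zero_iff]; omega
  subst hm2
  have : ∑ h : G, rename (fun g => h * g)
      (monomial (Finsupp.single g 1 + (Finsupp.single g' 1 + 0)) a) =
        C a * quad (g⁻¹ * g') := by
    simp only [quad, Finset.mul_sum]
    refine Fintype.sum_equiv (Equiv.mulRight g) _ _ fun h => ?_
    simp [rename_monomial, Finsupp.mapDomain_add, X, monomial_mul, C_mul_monomial, mul_assoc, -eq_intCast]
  rw [this]
  exact A.mul_mem (hC a) (h2 (by omega) _)

theorem avg_inv (p : MvPolynomial G ℤ) (hp : ∀ h : G, rename (fun g => h * g) p = p) :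
    ∑ h : G, rename (fun g => h * g) p = C (Fintype.card G : ℤ) * p := by
  simp [hp]

/-- degrees -/
def deg [LinearOrder G] (g : G) : ℕ := if g = 1 then 1 else if g ≤ g⁻¹ then 2 else 3

/-- the family -/
noncomputable def fam [LinearOrder G] (g : G) : MvPolynomial G ℤ :=
  if g = 1 then lin G else if g ≤ g⁻¹ then quad g else cub g

theorem fam_indep [LinearOrder G] : AlgebraicIndependent ℤ (fam (G := G)) := by
  refine jacobian _ (Pi.single 1 1) fun w hw => ?_
  have hq : ∀ a : G, a ≠ 1 → a ≤ a⁻¹ → w a⁻¹ + w a = 0 := by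
    intro a ha h
    have := hw a
    simpa [fam, ha, h, quad_deriv, add_mul, Finset.sum_add_distrib] using this
  have hc : ∀ a : G, a ≠ 1 → ¬ a ≤ a⁻¹ → w a = 0 := by
    intro a ha h
    have := hw a
    simp only [fam, ha, h, if_false, cub_deriv _ _ ha] at this
    simpa using this
  have hne : ∀ a : G, a ≠ 1 → w a = 0 := by
    intro a ha
    by_cases h : a ≤ a⁻¹
    · have h1 := hq a ha h
      by_cases h2 : a = a⁻¹
      · rw [← h2] at h1; omega
      · have := hc a⁻¹ (by simpa using ha) (by
          rw [inv_inv, not_le]; exact lt_of_le_of_ne h h2)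
        omega
    · exact hc a ha h
  have hl := hw 1
  simp only [fam, if_true, lin_deriv, one_mul] at hl
  rw [Finset.sum_eq_single 1 (fun b _ hb => hne b hb) (by simp)] at hl
  ext a
  rcases eq_or_ne a 1 with rfl | ha
  · exact hl
  · exact hne a ha

theorem fam_inv [LinearOrder G] (a h : G) : rename (fun g => h * g) (fam a) = fam a := by
  unfold fam
  split_ifs
  · exact lin_inv h
  · exact quad_inv a h
  · exact cub_inv a h

theorem fam_deg [LinearOrder G] (a : G) : (fam a).totalDegree = deg a := by
  refine IsHomogeneous.totalDegree ?_ (fam_indep.ne_zero a)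
  unfold fam deg
  split_ifs
  · exact lin_hom
  · exact quad_hom a
  · exact cub_hom a

theorem count_one [LinearOrder G] :
    (Finset.univ.filter fun g : G => deg g ≤ 1).card = 1 := by
  rw [Finset.card_eq_one]
  refine ⟨1, ?_⟩
  ext g
  rw [Finset.mem_filter, Finset.mem_singleton]
  unfold deg
  split_ifs <;> simp_all

theorem count_two [LinearOrder G] :
    2 * (Finset.univ.filter fun g : G => deg g ≤ 2).card =
      Nat.card G + Nat.card {g : G // orderOf g = 2} + 1 := by
  have e1 : (Finset.univ.filter fun g : G => deg g ≤ 2) =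
      Finset.univ.filter fun g : G => g ≤ g⁻¹ := by
    ext g
    rw [Finset.mem_filter, Finset.mem_filter]
    unfold deg
    split_ifs <;> simp_all
  have e2 : (Finset.univ.filter fun g : G => g ≤ g⁻¹).card =
      (Finset.univ.filter fun g : G => g⁻¹ ≤ g).card := by
    refine Finset.card_equiv (Equiv.inv G) fun g => ?_
    simp
  have e3 := Finset.card_union_add_card_inter (Finset.univ.filter fun g : G => g ≤ g⁻¹)
    (Finset.univ.filter fun g : G => g⁻¹ ≤ g)
  have e4 : (Finset.univ.filter fun g : G => g ≤ g⁻¹) ∪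
    (Finset.univ.filter fun g : G => g⁻¹ ≤ g) = Finset.univ := by
    ext g
    simp [le_total]
  have e5 : (Finset.univ.filter fun g : G => g ≤ g⁻¹) ∩
    (Finset.univ.filter fun g : G => g⁻¹ ≤ g) =
      insert 1 (Finset.univ.filter fun g : G => orderOf g = 2) := by
    ext g
    simp only [Finset.mem_inter, Finset.mem_filter, Finset.mem_univ, true_and,
      Finset.mem_insert, ← le_antisymm_iff]
    rcases eq_or_ne g 1 with rfl | hg
    · simp
    · simp only [hg, false_or]
      rw [orderOf_eq_prime_iff, pow_two, eq_inv_iff_mul_eq_one]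
      simp [hg]
  rw [e4, e5, Finset.card_insert_of_notMem (by simp), Finset.card_univ] at e3
  rw [e1, Nat.card_eq_fintype_card, Nat.card_eq_fintype_card, Fintype.card_subtype]
  omega

theorem quad_mem [LinearOrder G] (A : Subalgebra ℤ (MvPolynomial G ℤ))
    (hA : ∀ g : G, deg g ≤ 2 → fam g ∈ A) (a : G) : quad a ∈ A := by
  have hne : ∀ a : G, a ≠ 1 → quad a ∈ A := by
    intro a ha
    rcases le_total a a⁻¹ with h | h
    · have := hA a (by simp [deg, ha, h])
      simpa [fam, ha, h] using this
    · have := hA a⁻¹ (by simp [deg, ha, h])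
      rw [← quad_symm]
      simpa [fam, ha, h] using this
  rcases eq_or_ne a 1 with rfl | ha
  · have hl : lin G ∈ A := by
      have := hA 1 (by simp [deg])
      simpa [fam] using this
    have h := sum_quad (G := G)
    rw [← Finset.add_sum_erase _ _ (Finset.mem_univ 1)] at h
    rw [eq_sub_of_add_eq h]
    refine A.sub_mem (A.mul_mem hl hl) (A.sum_mem fun g hg => hne g ?_)
    simpa using hg
  · exact hne a ha

/-- lower bound, in counting form -/
theorem lower [LinearOrder G] {ι : Type} [Fintype ι] (f : ι → MvPolynomial G ℤ)
    (hf : AlgebraicIndependent ℤ f)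
    (hinv : ∀ i, ∀ h : G, rename (fun g => h * g) (f i) = f i) (k : ℕ) (hk : k ≤ 2)
    (hdeg : ∀ i, (f i).totalDegree ≤ k) :
    Fintype.card ι ≤ (Finset.univ.filter fun g : G => deg g ≤ k).card := by
  rw [← Fintype.card_subtype]
  refine card_le f (fun g : {g : G // deg g ≤ k} => fam g.1) hf fun i =>
    ⟨Fintype.card G, by simp, ?_⟩
  rw [← avg_inv (f i) (hinv i)]
  set A := Algebra.adjoin ℤ (Set.range fun g : {g : G // deg g ≤ k} => fam g.1) with hA
  have hm : ∀ g : G, deg g ≤ k → fam g ∈ A := fun g hg =>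
    Algebra.subset_adjoin ⟨⟨g, hg⟩, rfl⟩
  refine avg_mem A k hk (fun h1 => ?_) (fun h2 => ?_) (f i) (hdeg i)
  · have := hm 1 (by simpa [deg] using h1)
    simpa [fam] using this
  · exact quad_mem A fun g hg => hm g (hg.trans h2)

end

end Stmt18


/-- Theorem 6.1: for `G` a finite group of order `n` acting on `ℤ[x_g : g ∈ G]` by the
left regular representation (`h · x_g = x_{hg}`), with `n₂` the number of elements of
order `2` in `G`, there is an algebraically independent family of `G`-invariant
polynomials `f₁, …, f_n` whose (1-indexed) degree sequence is `1`, then `2` for the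
indices `2 ≤ i ≤ (n + n₂ + 1)/2`, then `3` for the remaining indices; moreover this
degree sequence is minimal among degree-monotone algebraically independent families of
`G`-invariants. -/
theorem stmt18 (G : Type) [Group G] [Finite G] :
    ∃ f : Fin (Nat.card G) → MvPolynomial G ℤ,
      AlgebraicIndependent ℤ f ∧
      (∀ i : Fin (Nat.card G), ∀ h : G,
        MvPolynomial.rename (fun g => h * g) (f i) = f i) ∧
      (∀ i : Fin (Nat.card G),
        ((i : ℕ) = 0 → (f i).totalDegree = 1) ∧
        (1 ≤ (i : ℕ) →
          2 * ((i : ℕ) + 1) ≤ Nat.card G + Nat.card {g : G // orderOf g = 2} + 1 →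
          (f i).totalDegree = 2) ∧
        (Nat.card G + Nat.card {g : G // orderOf g = 2} + 1 < 2 * ((i : ℕ) + 1) →
          (f i).totalDegree = 3)) ∧
      ∀ f' : Fin (Nat.card G) → MvPolynomial G ℤ,
        AlgebraicIndependent ℤ f' →
        (∀ i : Fin (Nat.card G), ∀ h : G,
          MvPolynomial.rename (fun g => h * g) (f' i) = f' i) →
        (∀ i j : Fin (Nat.card G), i ≤ j → (f' i).totalDegree ≤ (f' j).totalDegree) →
        ∀ i : Fin (Nat.card G), (f i).totalDegree ≤ (f' i).totalDegree := by
  classical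
  haveI : Fintype G := Fintype.ofFinite G
  letI : LinearOrder G := LinearOrder.lift' (Fintype.equivFin G) (Fintype.equivFin G).injective
  have e0 : Fin (Nat.card G) ≃ G := (Finite.equivFin G).symm
  set σ : Fin (Nat.card G) ≃ G :=
    (Tuple.sort (fun i => Stmt18.deg (e0 i))).trans e0 with hσ
  have hmono : Monotone fun i => Stmt18.deg (σ i) :=
    Tuple.monotone_sort (fun i => Stmt18.deg (e0 i))
  have hcard : ∀ k, (Finset.univ.filter fun i => Stmt18.deg (σ i) ≤ k).card =
      (Finset.univ.filter fun g : G => Stmt18.deg g ≤ k).card := fun k =>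
    Finset.card_equiv σ fun i => by simp
  have hle : ∀ (k : ℕ) (i : Fin (Nat.card G)), Stmt18.deg (σ i) ≤ k ↔
      (i : ℕ) < (Finset.univ.filter fun g : G => Stmt18.deg g ≤ k).card := by
    intro k i
    rw [← hcard]
    exact (Tuple.lt_card_le_iff_apply_le_of_monotone hmono).symm
  have hpos : ∀ g : G, 1 ≤ Stmt18.deg g ∧ Stmt18.deg g ≤ 3 := by
    intro g
    unfold Stmt18.deg
    split_ifs <;> simp
  have c1 := Stmt18.count_one (G := G)
  have c2 := Stmt18.count_two (G := G)
  refine ⟨fun i => Stmt18.fam (σ i), Stmt18.fam_indep.comp _ σ.injective,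
    fun i h => Stmt18.fam_inv _ h, fun i => ?_, ?_⟩
  · have h1 := hle 1 i
    have h2 := hle 2 i
    have h3 := hpos (σ i)
    rw [c1] at h1
    simp only [Stmt18.fam_deg]
    refine ⟨fun h => ?_, fun h h' => ?_, fun h => ?_⟩
    · have := h1.mpr (by omega)
      omega
    · have a1 : ¬ Stmt18.deg (σ i) ≤ 1 := fun hh => by have := h1.mp hh; omega
      have a2 := h2.mpr (by omega)
      omega
    · have a2 : ¬ Stmt18.deg (σ i) ≤ 2 := fun hh => by have := h2.mp hh; omega
      omega
  · intro f' hf' hinv hmon i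
    rw [Stmt18.fam_deg]
    by_contra! hlt
    have h3 := hpos (σ i)
    have hl := Stmt18.lower (fun j : {j // j ≤ i} => f' j.1)
      (hf'.comp _ Subtype.val_injective) (fun j h => hinv j.1 h) (f' i).totalDegree (by omega)
      (fun j => hmon _ _ j.2)
    have hc : Fintype.card {j // j ≤ i} = i + 1 := by
      rw [Fintype.card_subtype, ← Fin.card_Iic]
      congr 1
      ext j
      rw [Finset.mem_filter, Finset.mem_Iic]
      simp only [Finset.mem_univ, true_and]
    rw [hc] at hl
    have := (hle (f' i).totalDegree i).mpr (by omega)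
    omega
end
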